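/- The Σ-induced multi-rb culpability measure m^Σ_{C_D} induced by the drastic culpability measure C_D satisfies Multiset Monotony (MO): for every multiset of rule bases M and every rule r, V̂^{m^Σ_{C_D}}(M ∪ {r}) ≥ V̂^{m^Σ_{C_D}}(M). -/

import Mathlib

open scoped Classical

/-- A literal over a set of atoms `A`: an atom or its negation. -/
inductive Literal (A : Type) where
  | pos (a : A)
  | neg (a : A)
deriving DecidableEq

/-- A business rule `l₁,...,lₘ → l₀`: a finite body of literals and a head literal.
A rule with empty body is a fact. -/
structure Rule (A : Type) where
  body : Finset (Literal A)
  head : Literal A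

instance {A : Type} [DecidableEq A] : DecidableEq (Rule A) :=
  fun r s => decidable_of_iff (r.body = s.body ∧ r.head = s.head)
    (by cases r; cases s; simp)

/-- A set of literals `M` is closed w.r.t. a rule base `B` if for every rule of `B`
whose body is contained in `M`, its head is in `M`. -/
def LitsClosed {A : Type} (B : Finset (Rule A)) (M : Set (Literal A)) : Prop :=
  ∀ r ∈ B, (∀ l ∈ r.body, l ∈ M) → r.head ∈ M

/-- The minimal model of a rule base: the smallest closed set of literals. -/
def minModel {A : Type} (B : Finset (Rule A)) : Set (Literal A) :=
  ⋂₀ {M : Set (Literal A) | LitsClosed B M}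

/-- A set of literals is consistent if it contains no atom together with its negation. -/
def ConsistentLits {A : Type} (M : Set (Literal A)) : Prop :=
  ∀ a : A, ¬ (Literal.pos a ∈ M ∧ Literal.neg a ∈ M)

/-- A rule base is consistent if its minimal model is consistent. -/
def RBConsistent {A : Type} (B : Finset (Rule A)) : Prop :=
  ConsistentLits (minModel B)

/-- `MI B`: the minimal inconsistent subsets of `B`. -/
noncomputable def MI {A : Type} [DecidableEq A] (B : Finset (Rule A)) :
    Finset (Finset (Rule A)) :=
  B.powerset.filter fun M => ¬ RBConsistent M ∧ ∀ M' ∈ M.powerset, M' ≠ M → RBConsistent M'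

/-- `F(B)`: the facts (rules with empty body) of a rule base. -/
noncomputable def factsOf {A : Type} (B : Finset (Rule A)) : Finset (Rule A) :=
  B.filter fun r => r.body = ∅

/-- `R(B)`: the non-fact rules of a rule base. -/
noncomputable def rulesOf {A : Type} (B : Finset (Rule A)) : Finset (Rule A) :=
  B.filter fun r => r.body ≠ ∅

/-- The Σ-induced multi-rb culpability measure: a multiset of rule bases is given by a shared
rule set `R` and case-dependent fact sets `F i`, so that `Bᵢ = F i ∪ R`;
then `m^Σ_C(M, r) = Σᵢ C(Bᵢ, r)`. -/
noncomputable def mSigma {A : Type} [DecidableEq A] {n : ℕ}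
    (C : Finset (Rule A) → Rule A → ENNReal)
    (R : Finset (Rule A)) (F : Fin n → Finset (Rule A)) (r : Rule A) : ENNReal :=
  ∑ i : Fin n, C (F i ∪ R) r

/-- `V̂^{C^m}(M) = max_{r ∈ R(M)} C^m(M, r)` for the Σ-induced measure. -/
noncomputable def Vhat {A : Type} [DecidableEq A] {n : ℕ}
    (C : Finset (Rule A) → Rule A → ENNReal)
    (R : Finset (Rule A)) (F : Fin n → Finset (Rule A)) : ENNReal :=
  R.sup fun r => mSigma C R F r

/-- The drastic culpability measure `C_D`. -/
noncomputable def CD {A : Type} [DecidableEq A] (B : Finset (Rule A)) (r : Rule A) : ENNReal :=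
  if ∃ M ∈ MI B, r ∈ M then 1 else 0

theorem MI_mono {A : Type} [DecidableEq A] {B B' : Finset (Rule A)} (h : B ⊆ B') :
    MI B ⊆ MI B' :=
  Finset.filter_subset_filter _ (Finset.powerset_mono.2 h)

theorem CD_mono {A : Type} [DecidableEq A] {B B' : Finset (Rule A)} (h : B ⊆ B')
    (r : Rule A) : CD B r ≤ CD B' r := by
  unfold CD
  split_ifs with h₁ h₂
  · exact le_rfl
  · obtain ⟨M, hM, hr⟩ := h₁
    exact absurd ⟨M, MI_mono h hM, hr⟩ h₂
  · exact zero_le_one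
  · exact le_rfl

/-- `m^Σ_{C_D}` satisfies Multiset Monotony (MO):
adding a rule `r` to the shared rule set can only increase `V̂`. -/
theorem mSigma_CD_multiset_monotony {A : Type} [DecidableEq A] (n : ℕ)
    (R : Finset (Rule A)) (F : Fin n → Finset (Rule A))
    (hR : ∀ x ∈ R, x.body ≠ ∅) (hF : ∀ i : Fin n, ∀ x ∈ F i, Rule.body x = ∅)
    (r : Rule A) (hr : r.body ≠ ∅) :
    Vhat CD (insert r R) F ≥ Vhat CD R F := by
  refine Finset.sup_le fun x hx => ?_
  calc mSigma CD R F x ≤ mSigma CD (insert r R) F x :=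
        Finset.sum_le_sum fun i _ =>
          CD_mono (Finset.union_subset_union_right (Finset.subset_insert r R)) x
    _ ≤ Vhat CD (insert r R) F :=
        Finset.le_sup (f := fun y => mSigma CD (insert r R) F y) (Finset.mem_insert_of_mem hx)
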